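/- Regard the explicit 6×6 matrices X, Y, E₀,…,E₄ of the context as matrices over the field K = ℂ(t) of rational functions, and let 𝒜 := X + t·Y + 12·E₀ (the matrix of the linearized third variational equation of Painlevé II along y = 0). For any rational functions f₀, …, f₄ ∈ K, set N := f₀E₀ + f₁E₁ + f₂E₂ + f₃E₃ + f₄E₄ and P := I + N. Then N² = 0, P is invertible with P⁻¹ = I − N, and P·𝒜·P⁻¹ = 𝒜 + Σ_{i=0}^{4} f_i·⁅E_i, X + t·Y⁆. -/

import Mathlib

set_option synthInstance.maxHeartbeats 1000000
set_option maxHeartbeats 1000000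
noncomputable def Xm : Matrix (Fin 6) (Fin 6) (RatFunc ℂ) :=
  !![0,1,0,0,0,0; 0,0,2,0,0,0; 0,0,0,3,0,0; 0,0,0,0,0,0; 0,0,0,0,0,1; 0,0,0,0,0,0]

noncomputable def Ym : Matrix (Fin 6) (Fin 6) (RatFunc ℂ) :=
  !![0,0,0,0,0,0; 3,0,0,0,0,0; 0,2,0,0,0,0; 0,0,1,0,0,0; 0,0,0,0,0,0; 0,0,0,0,1,0]

noncomputable def E0 : Matrix (Fin 6) (Fin 6) (RatFunc ℂ) :=
  !![0,0,0,0,0,0; 0,0,0,0,0,0; 0,0,0,0,0,0; 0,0,0,0,0,0; 0,0,0,0,0,0; 1,0,0,0,0,0]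

noncomputable def E1 : Matrix (Fin 6) (Fin 6) (RatFunc ℂ) :=
  !![0,0,0,0,0,0; 0,0,0,0,0,0; 0,0,0,0,0,0; 0,0,0,0,0,0; 1,0,0,0,0,0; 0,-1,0,0,0,0]

noncomputable def E2 : Matrix (Fin 6) (Fin 6) (RatFunc ℂ) :=
  !![0,0,0,0,0,0; 0,0,0,0,0,0; 0,0,0,0,0,0; 0,0,0,0,0,0; 0,-1,0,0,0,0; 0,0,1,0,0,0]

noncomputable def E3 : Matrix (Fin 6) (Fin 6) (RatFunc ℂ) :=
  !![0,0,0,0,0,0; 0,0,0,0,0,0; 0,0,0,0,0,0; 0,0,0,0,0,0; 0,0,1,0,0,0; 0,0,0,-1,0,0]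

noncomputable def E4 : Matrix (Fin 6) (Fin 6) (RatFunc ℂ) :=
  !![0,0,0,0,0,0; 0,0,0,0,0,0; 0,0,0,0,0,0; 0,0,0,0,0,0; 0,0,0,-1,0,0; 0,0,0,0,0,0]

/-- The matrix of the linearized third variational equation of Painlevé II along `y = 0`. -/
noncomputable def 𝒜 : Matrix (Fin 6) (Fin 6) (RatFunc ℂ) :=
  Xm + (RatFunc.X : RatFunc ℂ) • Ym + (12 : RatFunc ℂ) • E0

/-- Two matrices with rows in the range of `Q` and columns in its kernel multiply to zero. -/
theorem mul_eq_zero_of_mul_eq_self {R : Type*} [Ring R] {Q A B : R}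
    (hA : A * Q = 0) (hB : Q * B = B) : A * B = 0 := by
  rw [← hB, ← mul_assoc, hA, zero_mul]

/-- Conjugation by `1 + N` when `N` is annihilated by `E` on both sides and `N * L * N = 0`. -/
theorem one_add_mul_mul_one_sub {R : Type*} [Ring R] {N L E : R}
    (hNE : N * E = 0) (hEN : E * N = 0) (hNLN : N * L * N = 0) :
    (1 + N) * (L + E) * (1 - N) = L + E + ⁅N, L⁆ := by
  have expand : (1 + N) * (L + E) * (1 - N) =
      L + E + (N * L - L * N) + N * E - E * N - N * L * N - N * E * N := by noncomm_ring
  rw [expand, hNE, hEN, hNLN, Ring.lie_def]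
  simp

/-- The projection onto the last two coordinates. -/
noncomputable def lastTwo : Matrix (Fin 6) (Fin 6) (RatFunc ℂ) :=
  Matrix.diagonal ![0, 0, 0, 0, 1, 1]

theorem lastTwo_mul_E :
    lastTwo * E0 = E0 ∧ lastTwo * E1 = E1 ∧ lastTwo * E2 = E2 ∧ lastTwo * E3 = E3 ∧
      lastTwo * E4 = E4 := by
  refine ⟨?_, ?_, ?_, ?_, ?_⟩ <;> ext i j <;> rw [lastTwo, Matrix.diagonal_mul] <;>
    fin_cases i <;> fin_cases j <;> simp [E0, E1, E2, E3, E4]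

theorem E_mul_lastTwo :
    E0 * lastTwo = 0 ∧ E1 * lastTwo = 0 ∧ E2 * lastTwo = 0 ∧ E3 * lastTwo = 0 ∧
      E4 * lastTwo = 0 := by
  refine ⟨?_, ?_, ?_, ?_, ?_⟩ <;> ext i j <;> rw [lastTwo, Matrix.mul_diagonal] <;>
    fin_cases i <;> fin_cases j <;> simp [E0, E1, E2, E3, E4]

theorem commute_lastTwo_Xm : Commute lastTwo Xm := by
  ext i j
  rw [lastTwo, Matrix.diagonal_mul, Matrix.mul_diagonal]
  fin_cases i <;> fin_cases j <;> simp [Xm]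

theorem commute_lastTwo_Ym : Commute lastTwo Ym := by
  ext i j
  rw [lastTwo, Matrix.diagonal_mul, Matrix.mul_diagonal]
  fin_cases i <;> fin_cases j <;> simp [Ym]

/-- Gauge transformation by `P = I + Σ fᵢ Eᵢ`: `N² = 0`, `P⁻¹ = I − N`, and
`P 𝒜 P⁻¹ = 𝒜 + Σ fᵢ ⁅Eᵢ, X + tY⁆`. -/
theorem stmt_5 (f₀ f₁ f₂ f₃ f₄ : RatFunc ℂ) :
    letI N : Matrix (Fin 6) (Fin 6) (RatFunc ℂ) :=
      f₀ • E0 + f₁ • E1 + f₂ • E2 + f₃ • E3 + f₄ • E4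
    letI P : Matrix (Fin 6) (Fin 6) (RatFunc ℂ) := 1 + N
    N * N = 0 ∧ IsUnit P ∧ P⁻¹ = 1 - N ∧
      P * 𝒜 * P⁻¹ =
        𝒜 + (f₀ • ⁅E0, Xm + (RatFunc.X : RatFunc ℂ) • Ym⁆ +
          f₁ • ⁅E1, Xm + (RatFunc.X : RatFunc ℂ) • Ym⁆ +
          f₂ • ⁅E2, Xm + (RatFunc.X : RatFunc ℂ) • Ym⁆ +
          f₃ • ⁅E3, Xm + (RatFunc.X : RatFunc ℂ) • Ym⁆ +
          f₄ • ⁅E4, Xm + (RatFunc.X : RatFunc ℂ) • Ym⁆) := by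
  set N : Matrix (Fin 6) (Fin 6) (RatFunc ℂ) :=
    f₀ • E0 + f₁ • E1 + f₂ • E2 + f₃ • E3 + f₄ • E4 with hN_def
  obtain ⟨l0, l1, l2, l3, l4⟩ := lastTwo_mul_E
  obtain ⟨r0, r1, r2, r3, r4⟩ := E_mul_lastTwo
  have hN : lastTwo * N = N := by
    simp only [hN_def, mul_add, mul_smul_comm, l0, l1, l2, l3, l4]
  have hN' : N * lastTwo = 0 := by
    simp only [hN_def, add_mul, smul_mul_assoc, r0, r1, r2, r3, r4, smul_zero, add_zero]
  have hE : lastTwo * ((12 : RatFunc ℂ) • E0) = (12 : RatFunc ℂ) • E0 := by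
    rw [mul_smul_comm, l0]
  have hE' : (12 : RatFunc ℂ) • E0 * lastTwo = 0 := by
    rw [smul_mul_assoc, r0, smul_zero]
  have hL : Commute lastTwo (Xm + (RatFunc.X : RatFunc ℂ) • Ym) :=
    commute_lastTwo_Xm.add_right (commute_lastTwo_Ym.smul_right _)
  have hNL : N * (Xm + (RatFunc.X : RatFunc ℂ) • Ym) * lastTwo = 0 := by
    rw [mul_assoc, ← hL.eq, ← mul_assoc, hN', zero_mul]
  have hNN : N * N = 0 := mul_eq_zero_of_mul_eq_self hN' hN
  have hPP : (1 + N) * (1 - N) = 1 := by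
    have expand : (1 + N) * (1 - N) = 1 - N * N := by noncomm_ring
    rw [expand, hNN, sub_zero]
  have hinv : (1 + N)⁻¹ = 1 - N := Matrix.inv_eq_right_inv hPP
  refine ⟨hNN, IsUnit.of_mul_eq_one _ hPP, hinv, ?_⟩
  rw [hinv, 𝒜, one_add_mul_mul_one_sub (mul_eq_zero_of_mul_eq_self hN' hE)
    (mul_eq_zero_of_mul_eq_self hE' hN) (mul_eq_zero_of_mul_eq_self hNL hN)]
  simp only [hN_def, Ring.lie_def, add_mul _ _ (Xm + _), mul_add (Xm + _), smul_mul_assoc _ _ (Xm + _),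
    mul_smul_comm _ (Xm + _), smul_sub]
  abel
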